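/- Let (Γ; ≤₁, …, ≤ₙ) be a homogeneous n-dimensional permutation structure. Let E, F, G₁, G₂ be ∅-definable equivalence relations on Γ with E ≤ F, and let < be a ∅-definable subquotient order from E to F (∅-definable: for every automorphism σ of Γ and all x, y, x < y iff σ(x) < σ(y)) such that for every ∅-definable equivalence relation H with E < H < F, < is not H-convex. Suppose E = G₁ ⊓ G₂ with G₁ ≠ E and G₂ ≠ E. Then the join G₁ ⊔ G₂ does not refine F (i.e., it is not the case that G₁ ⊔ G₂ ≤ F). -/

import Mathlib

/-- An `n`-dimensional permutation structure: a set `Γ` equipped with `n` linear orders. -/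
structure PermStruct (n : ℕ) (Γ : Type*) where
  le : Fin n → Γ → Γ → Prop
  total : ∀ i x y, le i x y ∨ le i y x
  antisymm : ∀ i x y, le i x y → le i y x → x = y
  trans : ∀ i x y z, le i x y → le i y z → le i x z

namespace PermStruct

variable {n : ℕ} {Γ : Type*} (S : PermStruct n Γ)

/-- An automorphism of the permutation structure: a bijection of `Γ` preserving each order. -/
def IsAuto (σ : Γ ≃ Γ) : Prop :=
  ∀ i x y, S.le i x y ↔ S.le i (σ x) (σ y)

/-- Homogeneity: every isomorphism between finite substructures (i.e. every bijection between
finite subsets preserving each order) extends to an automorphism. -/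
def Homogeneous : Prop :=
  ∀ (A : Finset Γ) (f : Γ → Γ), Set.InjOn f A →
    (∀ i, ∀ x ∈ A, ∀ y ∈ A, (S.le i x y ↔ S.le i (f x) (f y))) →
    ∃ σ : Γ ≃ Γ, S.IsAuto σ ∧ ∀ a ∈ A, σ a = f a

/-- A binary relation is ∅-definable iff it is invariant under all automorphisms. -/
def Definable (R : Γ → Γ → Prop) : Prop :=
  ∀ σ : Γ ≃ Γ, S.IsAuto σ → ∀ x y, R x y ↔ R (σ x) (σ y)

/-- `E` is `≤ᵢ`-convex: every `E`-class is an interval with respect to `≤ᵢ`. -/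
def Convex (i : Fin n) (E : Γ → Γ → Prop) : Prop :=
  ∀ x y z, S.le i x y → S.le i y z → E x z → E x y

end PermStruct

/-- Given equivalence relations `E ≤ F` on `X`, a subquotient order from `E` to `F` is a binary
relation `lt` such that: `lt x y` implies `F x y` and not `E x y`; `lt` is `E`-invariant on both
sides; `lt` is transitive; and whenever `F x y` and not `E x y`, exactly one of `lt x y`,
`lt y x` holds. -/
def IsSubquotientOrder {X : Type*} (E F lt : X → X → Prop) : Prop :=
  (∀ x y, lt x y → F x y ∧ ¬ E x y) ∧
  (∀ x y x' y', lt x y → E x x' → E y y' → lt x' y') ∧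
  (∀ x y z, lt x y → lt y z → lt x z) ∧
  (∀ x y, F x y → ¬ E x y → ((lt x y ∨ lt y x) ∧ ¬ (lt x y ∧ lt y x)))

namespace PermStruct

variable {n : ℕ} {Γ : Type*} {S : PermStruct n Γ}

theorem le_refl (S : PermStruct n Γ) (i : Fin n) (x : Γ) : S.le i x x :=
  (S.total i x x).elim id id

/-- The pairs `(x, y)` and `(x', y')` have the same quantifier-free type. -/
def SameType (S : PermStruct n Γ) (x y x' y' : Γ) : Prop :=
  (x = y ↔ x' = y') ∧ ∀ i, S.le i x y ↔ S.le i x' y'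

theorem SameType.rfl {x y : Γ} : S.SameType x y x y := ⟨Iff.rfl, fun _ => Iff.rfl⟩

theorem SameType.symm {x y x' y' : Γ} (h : S.SameType x y x' y') : S.SameType x' y' x y :=
  ⟨h.1.symm, fun i => (h.2 i).symm⟩

theorem SameType.trans {x y x' y' x'' y'' : Γ} (h : S.SameType x y x' y')
    (h' : S.SameType x' y' x'' y'') : S.SameType x y x'' y'' :=
  ⟨h.1.trans h'.1, fun i => (h.2 i).trans (h'.2 i)⟩

theorem SameType.diag (x x' : Γ) : S.SameType x x x' x' :=
  ⟨by simp, fun i => by simp [S.le_refl]⟩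

theorem SameType.swap {x y x' y' : Γ} (h : S.SameType x y x' y') : S.SameType y x y' x' := by
  refine ⟨by rw [eq_comm, h.1, eq_comm], fun i => ?_⟩
  by_cases hxy : x = y
  · obtain rfl := h.1.1 hxy
    subst hxy
    simp [S.le_refl]
  · have key : ∀ {u v : Γ}, u ≠ v → (S.le i v u ↔ ¬ S.le i u v) := fun huv =>
      ⟨fun hvu h' => huv (S.antisymm i _ _ h' hvu), fun h' => (S.total i _ _).resolve_left h'⟩
    rw [key hxy, key (mt h.1.2 hxy), h.2 i]

theorem IsAuto.sameType {σ : Γ ≃ Γ} (hσ : S.IsAuto σ) (x y : Γ) :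
    S.SameType x y (σ x) (σ y) :=
  ⟨σ.injective.eq_iff.symm, fun i => hσ i x y⟩

theorem IsAuto.symm {σ : Γ ≃ Γ} (hσ : S.IsAuto σ) : S.IsAuto σ.symm := fun i x y => by
  simpa using (hσ i (σ.symm x) (σ.symm y)).symm

theorem definable_of_imp {R : Γ → Γ → Prop}
    (h : ∀ σ : Γ ≃ Γ, S.IsAuto σ → ∀ x y, R x y → R (σ x) (σ y)) : S.Definable R :=
  fun σ hσ x y => ⟨h σ hσ x y, fun hr => by simpa using h σ.symm hσ.symm _ _ hr⟩

theorem Homogeneous.exists_auto (hS : S.Homogeneous) {ι : Type*} [Finite ι] (p q : ι → Γ)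
    (h : ∀ i j, S.SameType (p i) (p j) (q i) (q j)) :
    ∃ σ : Γ ≃ Γ, S.IsAuto σ ∧ ∀ i, σ (p i) = q i := by
  classical
  have hf : q.FactorsThrough p := fun i j hij => (h i j).1.1 hij
  have hval : ∀ i, Function.extend p q id (p i) = q i := fun i => hf.extend_apply _ i
  obtain ⟨σ, hσ, hσ'⟩ := hS (Set.finite_range p).toFinset (Function.extend p q id)
    (by
      intro x hx y hy hxy
      simp only [Set.Finite.coe_toFinset, Set.mem_range] at hx hy
      obtain ⟨i, rfl⟩ := hx
      obtain ⟨j, rfl⟩ := hy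
      rw [hval, hval] at hxy
      exact (h i j).1.2 hxy)
    (by
      intro k x hx y hy
      simp only [Set.Finite.mem_toFinset, Set.mem_range] at hx hy
      obtain ⟨i, rfl⟩ := hx
      obtain ⟨j, rfl⟩ := hy
      rw [hval, hval]
      exact (h i j).2 k)
  exact ⟨σ, hσ, fun i => by rw [hσ' _ (by simp), hval]⟩

theorem Homogeneous.exists_auto_triple (hS : S.Homogeneous) {x y z x' y' z' : Γ}
    (hxy : S.SameType x y x' y') (hyz : S.SameType y z y' z') (hxz : S.SameType x z x' z') :
    ∃ σ : Γ ≃ Γ, S.IsAuto σ ∧ σ x = x' ∧ σ y = y' ∧ σ z = z' := by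
  obtain ⟨σ, hσ, h⟩ := hS.exists_auto ![x, y, z] ![x', y', z'] (by
    simp only [Fin.forall_fin_succ, Fin.forall_fin_zero]
    simp [hxy, hyz, hxz, hxy.swap, hyz.swap, hxz.swap, SameType.diag])
  exact ⟨σ, hσ, h 0, h 1, h 2⟩

theorem Homogeneous.exists_auto_pair (hS : S.Homogeneous) {x y x' y' : Γ}
    (hxy : S.SameType x y x' y') : ∃ σ : Γ ≃ Γ, S.IsAuto σ ∧ σ x = x' ∧ σ y = y' := by
  obtain ⟨σ, hσ, h₁, h₂, -⟩ := hS.exists_auto_triple hxy (SameType.diag y y') hxy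
  exact ⟨σ, hσ, h₁, h₂⟩

theorem Homogeneous.exists_auto_apply_eq (hS : S.Homogeneous) (x x' : Γ) :
    ∃ σ : Γ ≃ Γ, S.IsAuto σ ∧ σ x = x' := by
  obtain ⟨σ, hσ, h, -⟩ := hS.exists_auto_pair (SameType.diag x x')
  exact ⟨σ, hσ, h⟩

theorem Definable.iff_of_sameType {R : Γ → Γ → Prop} (hR : S.Definable R) (hS : S.Homogeneous)
    {x y x' y' : Γ} (h : S.SameType x y x' y') : R x y ↔ R x' y' := by
  obtain ⟨σ, hσ, rfl, rfl⟩ := hS.exists_auto_pair h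
  exact hR σ hσ x y

theorem Definable.exists_right {R : Γ → Γ → Prop} (hR : S.Definable R) (hS : S.Homogeneous)
    {x y : Γ} (h : R x y) (x' : Γ) : ∃ y', R x' y' := by
  obtain ⟨σ, hσ, rfl⟩ := hS.exists_auto_apply_eq x x'
  exact ⟨σ y, (hR σ hσ x y).1 h⟩

theorem Definable.flip {R : Γ → Γ → Prop} (hR : S.Definable R) : S.Definable (flip R) :=
  fun σ hσ x y => hR σ hσ y x

theorem sameType_definable (b a : Γ) : S.Definable (S.SameType b a) :=
  definable_of_imp fun _ hσ x y h => h.trans (hσ.sameType x y)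

theorem Homogeneous.finite_definable (hS : S.Homogeneous) : {R | S.Definable R}.Finite := by
  refine Set.Finite.of_finite_image (f := fun R =>
    {s : Prop × (Fin n → Prop) | ∃ x y, R x y ∧ s = (x = y, fun i => S.le i x y)})
    (Set.toFinite _) ?_
  have key : ∀ R R' : Γ → Γ → Prop, S.Definable R' →
      {s : Prop × (Fin n → Prop) | ∃ x y, R x y ∧ s = (x = y, fun i => S.le i x y)} =
      {s : Prop × (Fin n → Prop) | ∃ x y, R' x y ∧ s = (x = y, fun i => S.le i x y)} →
      ∀ x y, R x y → R' x y := by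
    intro R R' hR' heq x y hxy
    have hmem : ((x = y, fun i => S.le i x y) : Prop × (Fin n → Prop)) ∈
        {s : Prop × (Fin n → Prop) | ∃ x y, R' x y ∧ s = (x = y, fun i => S.le i x y)} :=
      heq ▸ ⟨x, y, hxy, rfl⟩
    obtain ⟨x', y', h', he⟩ := hmem
    rw [Prod.mk.injEq] at he
    refine (hR'.iff_of_sameType hS ⟨?_, fun i => ?_⟩).2 h'
    · exact iff_of_eq he.1
    · exact iff_of_eq (congrFun he.2 i)
  intro R hR R' hR' heq
  funext x y
  exact propext ⟨key R R' hR' heq x y, key R' R hR heq.symm x y⟩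

end PermStruct

/-- A ∅-definable subquotient order from `E` to `F`, in a homogeneous permutation structure, that
is convex for no ∅-definable equivalence relation strictly between `E` and `F`. -/
structure MinimalSubquotientOrder {n : ℕ} {Γ : Type*} (S : PermStruct n Γ)
    (E F lt : Γ → Γ → Prop) : Prop where
  homogeneous : S.Homogeneous
  definable_bot : S.Definable E
  equiv_bot : Equivalence E
  equiv_top : Equivalence F
  bot_le_top : ∀ x y, E x y → F x y
  isSubquotientOrder : IsSubquotientOrder E F lt
  definable : S.Definable lt
  not_convex : ∀ H : Γ → Γ → Prop, S.Definable H → Equivalence H →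
      (∀ x y, E x y → H x y) → (¬ ∀ x y, H x y → E x y) →
      (∀ x y, H x y → F x y) → (¬ ∀ x y, F x y → H x y) →
      ¬ (∀ x y z, lt x y → lt y z → H x z → H x y)

namespace MinimalSubquotientOrder

open PermStruct

variable {n : ℕ} {Γ : Type*} {S : PermStruct n Γ} {E F lt : Γ → Γ → Prop}

theorem trans (h : MinimalSubquotientOrder S E F lt) {x y z : Γ} (hxy : lt x y) (hyz : lt y z) :
    lt x z :=
  h.isSubquotientOrder.2.2.1 x y z hxy hyz

theorem top_of_lt (h : MinimalSubquotientOrder S E F lt) {x y : Γ} (hxy : lt x y) : F x y :=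
  (h.isSubquotientOrder.1 x y hxy).1

theorem not_bot_of_lt (h : MinimalSubquotientOrder S E F lt) {x y : Γ} (hxy : lt x y) :
    ¬ E x y :=
  (h.isSubquotientOrder.1 x y hxy).2

theorem asymm (h : MinimalSubquotientOrder S E F lt) {x y : Γ} (hxy : lt x y) : ¬ lt y x :=
  fun hyx => (h.isSubquotientOrder.2.2.2 x y (h.top_of_lt hxy) (h.not_bot_of_lt hxy)).2 ⟨hxy, hyx⟩

theorem irrefl (h : MinimalSubquotientOrder S E F lt) (x : Γ) : ¬ lt x x :=
  fun hx => h.asymm hx hx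

theorem lt_of_lt_of_bot (h : MinimalSubquotientOrder S E F lt) {x y z : Γ} (hxy : lt x y)
    (hyz : E y z) : lt x z :=
  h.isSubquotientOrder.2.1 x y x z hxy (h.equiv_bot.refl x) hyz

theorem lt_of_bot_of_lt (h : MinimalSubquotientOrder S E F lt) {x y z : Γ} (hxy : E x y)
    (hyz : lt y z) : lt x z :=
  h.isSubquotientOrder.2.1 y z x z hyz (h.equiv_bot.symm hxy) (h.equiv_bot.refl z)

theorem trichotomy (h : MinimalSubquotientOrder S E F lt) {x y : Γ} (hxy : F x y) :
    lt x y ∨ E x y ∨ lt y x := by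
  by_cases hE : E x y
  · exact Or.inr (Or.inl hE)
  · rcases (h.isSubquotientOrder.2.2.2 x y hxy hE).1 with h' | h'
    · exact Or.inl h'
    · exact Or.inr (Or.inr h')

theorem flip (h : MinimalSubquotientOrder S E F lt) :
    MinimalSubquotientOrder S E F (flip lt) where
  homogeneous := h.homogeneous
  definable_bot := h.definable_bot
  equiv_bot := h.equiv_bot
  equiv_top := h.equiv_top
  bot_le_top := h.bot_le_top
  isSubquotientOrder := by
    refine ⟨fun x y hxy => ⟨h.equiv_top.symm (h.top_of_lt hxy),
        fun hE => h.not_bot_of_lt hxy (h.equiv_bot.symm hE)⟩,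
      fun x y x' y' hxy hx hy => h.isSubquotientOrder.2.1 y x y' x' hxy hy hx,
      fun x y z hxy hyz => h.trans hyz hxy, fun x y hF hE => ⟨?_, fun hc => h.asymm hc.1 hc.2⟩⟩
    rcases h.trichotomy hF with h' | h' | h'
    · exact Or.inr h'
    · exact absurd h' hE
    · exact Or.inl h'
  definable := h.definable.flip
  not_convex := by
    intro H hd he h₁ h₂ h₃ h₄ hc
    refine h.not_convex H hd he h₁ h₂ h₃ h₄ fun x y z hxy hyz hxz => ?_
    exact he.trans hxz (hc z y x hyz hxy (he.symm hxz))

/-- The weak order associated with a subquotient order. -/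
def Le (E lt : Γ → Γ → Prop) (x y : Γ) : Prop := lt x y ∨ E x y

theorem le_refl (h : MinimalSubquotientOrder S E F lt) (x : Γ) : Le E lt x x :=
  Or.inr (h.equiv_bot.refl x)

theorem lt_of_lt_of_le (h : MinimalSubquotientOrder S E F lt) {x y z : Γ} (hxy : lt x y)
    (hyz : Le E lt y z) : lt x z :=
  hyz.elim (h.trans hxy) (h.lt_of_lt_of_bot hxy)

theorem lt_of_le_of_lt (h : MinimalSubquotientOrder S E F lt) {x y z : Γ} (hxy : Le E lt x y)
    (hyz : lt y z) : lt x z :=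
  hxy.elim (fun h' => h.trans h' hyz) (fun h' => h.lt_of_bot_of_lt h' hyz)

theorem le_trans (h : MinimalSubquotientOrder S E F lt) {x y z : Γ} (hxy : Le E lt x y)
    (hyz : Le E lt y z) : Le E lt x z := by
  rcases hxy with hxy | hxy
  · exact Or.inl (h.lt_of_lt_of_le hxy hyz)
  · rcases hyz with hyz | hyz
    · exact Or.inl (h.lt_of_bot_of_lt hxy hyz)
    · exact Or.inr (h.equiv_bot.trans hxy hyz)

theorem lt_or_le (h : MinimalSubquotientOrder S E F lt) {x y : Γ} (hxy : F x y) :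
    lt x y ∨ Le E lt y x := by
  rcases h.trichotomy hxy with h' | h' | h'
  · exact Or.inl h'
  · exact Or.inr (Or.inr (h.equiv_bot.symm h'))
  · exact Or.inr (Or.inl h')

theorem top_of_le (h : MinimalSubquotientOrder S E F lt) {x y : Γ} (hxy : Le E lt x y) : F x y :=
  hxy.elim h.top_of_lt (h.bot_le_top x y)

theorem le_apply (h : MinimalSubquotientOrder S E F lt) {σ : Γ ≃ Γ} (hσ : S.IsAuto σ) {x y : Γ} :
    Le E lt x y ↔ Le E lt (σ x) (σ y) :=
  or_congr (h.definable σ hσ x y) (h.definable_bot σ hσ x y)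

theorem sameType_lt (h : MinimalSubquotientOrder S E F lt) {b a x y : Γ} (hba : lt b a)
    (hxy : S.SameType b a x y) : lt x y :=
  (h.definable.iff_of_sameType h.homogeneous hxy).1 hba

theorem sameType_trans (h : MinimalSubquotientOrder S E F lt) {b a x y z : Γ} (hba : lt b a)
    (hxy : S.SameType b a x y) (hyz : S.SameType b a y z) : S.SameType b a x z := by
  have hne : ∀ {u v : Γ}, lt u v → u ≠ v := fun huv he => h.irrefl _ (he ▸ huv)
  have hlxy := h.sameType_lt hba hxy
  have hlyz := h.sameType_lt hba hyz
  have hlxz := h.trans hlxy hlyz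
  refine ⟨iff_of_false (hne hba) (hne hlxz), fun i => ?_⟩
  constructor
  · intro hi
    exact S.trans i x y z ((hxy.2 i).1 hi) ((hyz.2 i).1 hi)
  · intro hi
    by_contra hn
    have h₁ : S.le i y x := (S.total i x y).resolve_left (mt (hxy.2 i).2 hn)
    have h₂ : S.le i z y := (S.total i y z).resolve_left (mt (hyz.2 i).2 hn)
    exact hne hlxz (S.antisymm i x z hi (S.trans i z y x h₂ h₁))

/-- A ∅-definable relation inside `lt` passing to subintervals is trivial. -/
theorem not_exists_of_subinterval (h : MinimalSubquotientOrder S E F lt) {K : Γ → Γ → Prop}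
    (hK : S.Definable K) (hKlt : ∀ x y, K x y → lt x y)
    (hKint : ∀ x y x' y', K x y → Le E lt x x' → Le E lt y' y → lt x' y' → K x' y')
    (hproper : ∃ x y, lt x y ∧ ¬ K x y) (a b : Γ) : ¬ K a b := by
  intro hab
  let P : Set (Γ → Γ → Prop) := {K | S.Definable K ∧ (∀ x y, K x y → lt x y) ∧
    (∀ x y x' y', K x y → Le E lt x x' → Le E lt y' y → lt x' y' → K x' y') ∧
    (∃ x y, lt x y ∧ ¬ K x y) ∧ K a b}
  have hPfin : P.Finite := h.homogeneous.finite_definable.subset fun K hK => hK.1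
  obtain ⟨M, hM⟩ := hPfin.exists_maximal ⟨K, hK, hKlt, hKint, hproper, hab⟩
  obtain ⟨⟨hMd, hMlt, hMint, ⟨x₀, y₀, hxy₀, hn₀⟩, hMab⟩, hmax⟩ := hM
  let M' : Γ → Γ → Prop := fun x y => M x y ∨ ∃ p, M x p ∧ M p y
  have hM'd : S.Definable M' := definable_of_imp fun σ hσ x y => by
    rintro (hm | ⟨p, h₁, h₂⟩)
    · exact Or.inl ((hMd σ hσ x y).1 hm)
    · exact Or.inr ⟨σ p, (hMd σ hσ x p).1 h₁, (hMd σ hσ p y).1 h₂⟩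
  have hM'lt : ∀ x y, M' x y → lt x y := by
    rintro x y (hm | ⟨p, h₁, h₂⟩)
    · exact hMlt x y hm
    · exact h.trans (hMlt _ _ h₁) (hMlt _ _ h₂)
  have hnext : ∀ x, ∃ y, lt x y ∧ ¬ M x y := by
    have hd : S.Definable fun x y => lt x y ∧ ¬ M x y := fun σ hσ x y =>
      and_congr (h.definable σ hσ x y) (not_congr (hMd σ hσ x y))
    exact hd.exists_right h.homogeneous ⟨hxy₀, hn₀⟩
  by_cases hp : ∃ x y, lt x y ∧ ¬ M' x y
  · have hM'int : ∀ x y x' y', M' x y → Le E lt x x' → Le E lt y' y → lt x' y' → M' x' y' := by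
      rintro x y x' y' (hm | ⟨p, h₁, h₂⟩) hx hy hlt
      · exact Or.inl (hMint x y x' y' hm hx hy hlt)
      · have hFx : F x' p := h.equiv_top.trans (h.equiv_top.symm (h.top_of_le hx))
          (h.top_of_lt (hMlt _ _ h₁))
        rcases h.lt_or_le hFx with hxp | hpx
        · have hFy : F p y' := h.equiv_top.trans (h.equiv_top.symm hFx) (h.top_of_lt hlt)
          rcases h.lt_or_le hFy with hpy | hyp
          · exact Or.inr ⟨p, hMint x p x' p h₁ hx (h.le_refl p) hxp,
              hMint p y p y' h₂ (h.le_refl p) hy hpy⟩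
          · exact Or.inl (hMint x p x' y' h₁ hx hyp hlt)
        · exact Or.inl (hMint p y x' y' h₂ hpx hy hlt)
    have hle : M' ≤ M := hmax ⟨hM'd, hM'lt, hM'int, hp, Or.inl hMab⟩ fun x y hm => Or.inl hm
    have hMtrans : ∀ {x y z}, M x y → M y z → M x z := fun {x y z} h₁ h₂ =>
      hle x z (Or.inr ⟨y, h₁, h₂⟩)
    have hME : ∀ {x y z}, M x y → E y z → M x z := fun {x y z} h₁ h₂ =>
      hMint x y x z h₁ (h.le_refl x) (Or.inr (h.equiv_bot.symm h₂))
        (h.lt_of_lt_of_bot (hMlt _ _ h₁) h₂)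
    have hEM : ∀ {x y z}, E x y → M y z → M x z := fun {x y z} h₁ h₂ =>
      hMint y z x z h₂ (Or.inr (h.equiv_bot.symm h₁)) (h.le_refl z)
        (h.lt_of_bot_of_lt h₁ (hMlt _ _ h₂))
    refine h.not_convex (fun x y => E x y ∨ M x y ∨ M y x) ?_ ⟨?_, ?_, ?_⟩ ?_ ?_ ?_ ?_ ?_
    · exact fun σ hσ x y => or_congr (h.definable_bot σ hσ x y)
        (or_congr (hMd σ hσ x y) (hMd σ hσ y x))
    · exact fun x => Or.inl (h.equiv_bot.refl x)
    · rintro x y (h' | h' | h')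
      · exact Or.inl (h.equiv_bot.symm h')
      · exact Or.inr (Or.inr h')
      · exact Or.inr (Or.inl h')
    · rintro x y z (h₁ | h₁ | h₁) (h₂ | h₂ | h₂)
      · exact Or.inl (h.equiv_bot.trans h₁ h₂)
      · exact Or.inr (Or.inl (hEM h₁ h₂))
      · exact Or.inr (Or.inr (hME h₂ (h.equiv_bot.symm h₁)))
      · exact Or.inr (Or.inl (hME h₁ h₂))
      · exact Or.inr (Or.inl (hMtrans h₁ h₂))
      · have hF : F x z := h.equiv_top.trans (h.top_of_lt (hMlt _ _ h₁))
          (h.equiv_top.symm (h.top_of_lt (hMlt _ _ h₂)))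
        rcases h.trichotomy hF with h' | h' | h'
        · exact Or.inr (Or.inl (hMint x y x z h₁ (h.le_refl x) (Or.inl (hMlt _ _ h₂)) h'))
        · exact Or.inl h'
        · exact Or.inr (Or.inr (hMint z y z x h₂ (h.le_refl z) (Or.inl (hMlt _ _ h₁)) h'))
      · exact Or.inr (Or.inr (hEM (h.equiv_bot.symm h₂) h₁))
      · have hF : F x z := h.equiv_top.trans (h.equiv_top.symm (h.top_of_lt (hMlt _ _ h₁)))
          (h.top_of_lt (hMlt _ _ h₂))
        rcases h.trichotomy hF with h' | h' | h'
        · exact Or.inr (Or.inl (hMint y z x z h₂ (Or.inl (hMlt _ _ h₁)) (h.le_refl z) h'))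
        · exact Or.inl h'
        · exact Or.inr (Or.inr (hMint y x z x h₁ (Or.inl (hMlt _ _ h₂)) (h.le_refl x) h'))
      · exact Or.inr (Or.inr (hMtrans h₂ h₁))
    · exact fun x y hxy => Or.inl hxy
    · exact fun hall => h.not_bot_of_lt (hMlt _ _ hMab) (hall a b (Or.inr (Or.inl hMab)))
    · rintro x y (h' | h' | h')
      · exact h.bot_le_top x y h'
      · exact h.top_of_lt (hMlt _ _ h')
      · exact h.equiv_top.symm (h.top_of_lt (hMlt _ _ h'))
    · intro hall
      rcases hall x₀ y₀ (h.top_of_lt hxy₀) with h' | h' | h'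
      · exact h.not_bot_of_lt hxy₀ h'
      · exact hn₀ h'
      · exact h.asymm hxy₀ (hMlt _ _ h')
    · rintro x y z hxy hyz (h' | h' | h')
      · exact absurd h' (h.not_bot_of_lt (h.trans hxy hyz))
      · exact Or.inr (Or.inl (hMint x z x y h' (h.le_refl x) (Or.inl hyz) hxy))
      · exact absurd (hMlt _ _ h') (h.asymm (h.trans hxy hyz))
  · push Not at hp
    obtain ⟨y₁, hlt₁, hn₁⟩ := hnext y₀
    rcases hp x₀ y₁ (h.trans hxy₀ hlt₁) with hm | ⟨p, h₁, h₂⟩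
    · exact hn₀ (hMint _ _ _ _ hm (h.le_refl _) (Or.inl hlt₁) hxy₀)
    · have hF : F p y₀ := h.equiv_top.trans (h.equiv_top.symm (h.top_of_lt (hMlt _ _ h₁)))
        (h.top_of_lt hxy₀)
      rcases h.lt_or_le hF with hpy | hyp
      · exact hn₁ (hMint _ _ _ _ h₂ (Or.inl hpy) (h.le_refl _) hlt₁)
      · exact hn₀ (hMint _ _ _ _ h₁ (h.le_refl _) hyp hxy₀)

end MinimalSubquotientOrder

/-- A ∅-definable relation inside `lt` whose sections are initial segments of the final segments
`{y | lt x y}`. -/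
structure IsRightInitial {n : ℕ} {Γ : Type*} (S : PermStruct n Γ) (E lt I : Γ → Γ → Prop) :
    Prop where
  definable : S.Definable I
  lt_of : ∀ {x y}, I x y → lt x y
  initial : ∀ {x y z}, I x y → lt x z → MinimalSubquotientOrder.Le E lt z y → I x z

/-- The least nonempty right-initial relation, when it is different from `lt`. -/
structure IsLeastRightInitial {n : ℕ} {Γ : Type*} (S : PermStruct n Γ) (E lt I : Γ → Γ → Prop) :
    Prop extends IsRightInitial S E lt I where
  nonempty : ∃ x y, I x y
  least : ∀ J, IsRightInitial S E lt J → (∃ x y, J x y) → ∀ {x y}, I x y → J x y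
  proper : ∃ x y, lt x y ∧ ¬ I x y

section RightInitial

open PermStruct MinimalSubquotientOrder

variable {n : ℕ} {Γ : Type*} {S : PermStruct n Γ} {E F lt I J : Γ → Γ → Prop}

theorem IsRightInitial.inf (hI : IsRightInitial S E lt I) (hJ : IsRightInitial S E lt J) :
    IsRightInitial S E lt fun x y => I x y ∧ J x y where
  definable := fun σ hσ x y => and_congr (hI.definable σ hσ x y) (hJ.definable σ hσ x y)
  lt_of := fun hxy => hI.lt_of hxy.1
  initial := fun hxy hxz hzy => ⟨hI.initial hxy.1 hxz hzy, hJ.initial hxy.2 hxz hzy⟩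

theorem IsRightInitial.exists_inf (h : MinimalSubquotientOrder S E F lt)
    (hI : IsRightInitial S E lt I) (hJ : IsRightInitial S E lt J) (hI' : ∃ x y, I x y)
    (hJ' : ∃ x y, J x y) : ∃ x y, I x y ∧ J x y := by
  obtain ⟨x, y, hxy⟩ := hI'
  obtain ⟨x', y', hxy'⟩ := hJ'
  obtain ⟨z, hz⟩ := hJ.definable.exists_right h.homogeneous hxy' x
  have hF : F y z := h.equiv_top.trans (h.equiv_top.symm (h.top_of_lt (hI.lt_of hxy)))
    (h.top_of_lt (hJ.lt_of hz))
  rcases h.lt_or_le hF with hyz | hzy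
  · exact ⟨x, y, hxy, hJ.initial hz (hI.lt_of hxy) (Or.inl hyz)⟩
  · exact ⟨x, z, hI.initial hxy (hJ.lt_of hz) hzy, hz⟩

theorem IsRightInitial.exists_isLeast (h : MinimalSubquotientOrder S E F lt)
    (hJ : IsRightInitial S E lt J) (hJ' : ∃ x y, J x y) (hproper : ∃ x y, lt x y ∧ ¬ J x y) :
    ∃ I, IsLeastRightInitial S E lt I := by
  let P : Set (Γ → Γ → Prop) := {I | IsRightInitial S E lt I ∧ ∃ x y, I x y}
  have hP : P.Finite := h.homogeneous.finite_definable.subset fun K hK => hK.1.definable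
  obtain ⟨I, hI⟩ := hP.exists_minimal ⟨J, hJ, hJ'⟩
  obtain ⟨⟨hI₁, hI₂⟩, hmin⟩ := hI
  have hleast : ∀ J, IsRightInitial S E lt J → (∃ x y, J x y) → ∀ {x y}, I x y → J x y := by
    intro J hJ hJ' x y hxy
    exact (hmin ⟨hI₁.inf hJ, hI₁.exists_inf h hJ hI₂ hJ'⟩ (fun x y h' => h'.1) x y hxy).2
  refine ⟨I, { hI₁ with nonempty := hI₂, least := hleast, proper := ?_ }⟩
  obtain ⟨x, y, hxy, hn⟩ := hproper
  exact ⟨x, y, hxy, fun h' => hn (hleast J hJ hJ' h')⟩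

namespace IsLeastRightInitial

theorem trans (h : MinimalSubquotientOrder S E F lt) (hI : IsLeastRightInitial S E lt I)
    {x y z : Γ} (hxy : I x y) (hyz : I y z) : I x z := by
  have hJ : IsRightInitial S E lt fun p q => lt p q ∧ ∃ r, S.SameType x y p r ∧ Le E lt q r :=
    { definable := definable_of_imp fun σ hσ p q => by
        rintro ⟨hpq, r, hr, hqr⟩
        exact ⟨(h.definable σ hσ p q).1 hpq, σ r, hr.trans (hσ.sameType p r),
          (h.le_apply hσ).1 hqr⟩
      lt_of := fun hpq => hpq.1
      initial := fun ⟨_, r, hr, hqr⟩ hpz hzq => ⟨hpz, r, hr, h.le_trans hzq hqr⟩ }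
  obtain ⟨-, r, hr, hzr⟩ := hI.least _ hJ ⟨x, y, hI.lt_of hxy, y, SameType.rfl, h.le_refl y⟩ hyz
  have hxr : S.SameType x y x r := h.sameType_trans (hI.lt_of hxy) SameType.rfl hr
  exact hI.initial ((hI.definable.iff_of_sameType h.homogeneous hxr).1 hxy)
    (h.trans (hI.lt_of hxy) (hI.lt_of hyz)) hzr

theorem exists_not (h : MinimalSubquotientOrder S E F lt) (hI : IsLeastRightInitial S E lt I)
    {x y : Γ} (hxy : lt x y) : ∃ x', Le E lt x x' ∧ lt x' y ∧ ¬ I x' y := by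
  by_contra! hc
  refine h.not_exists_of_subinterval
    (K := fun x y => lt x y ∧ ∀ x', Le E lt x x' → lt x' y → I x' y) ?_ (fun x y hK => hK.1)
    ?_ ?_ x y ⟨hxy, hc⟩
  · refine definable_of_imp fun σ hσ x y hK => ⟨(h.definable σ hσ x y).1 hK.1, fun x' hx' hy => ?_⟩
    obtain ⟨x', rfl⟩ := σ.surjective x'
    exact (hI.definable σ hσ _ _).1 (hK.2 x' ((h.le_apply hσ).2 hx') ((h.definable σ hσ _ _).2 hy))
  · rintro x y x' y' ⟨-, hK⟩ hxx hyy hlt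
    refine ⟨hlt, fun p hp hpy => ?_⟩
    exact hI.initial (hK p (h.le_trans hxx hp) (h.lt_of_lt_of_le hpy hyy)) hpy hyy
  · obtain ⟨x, y, hxy, hn⟩ := hI.proper
    exact ⟨x, y, hxy, fun hK => hn (hK.2 x (h.le_refl x) hxy)⟩

theorem exists_pair (h : MinimalSubquotientOrder S E F lt) (hI : IsLeastRightInitial S E lt I)
    (x : Γ) : ∃ z₁ z₂, I x z₁ ∧ I x z₂ ∧ lt z₁ z₂ ∧ ¬ I z₁ z₂ := by
  obtain ⟨p, q, hpq⟩ := hI.nonempty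
  obtain ⟨y, hxy⟩ := hI.definable.exists_right h.homogeneous hpq x
  obtain ⟨z₂, hyz⟩ := hI.definable.exists_right h.homogeneous hpq y
  obtain ⟨z₁, hy, hz, hn⟩ := hI.exists_not h (hI.lt_of hyz)
  have hxz := hI.trans h hxy hyz
  exact ⟨z₁, z₂, hI.initial hxz (h.lt_of_lt_of_le (hI.lt_of hxy) hy) (Or.inl hz), hxz, hz, hn⟩

end IsLeastRightInitial

end RightInitial

/-- `Y` carries a full binary tree of depth `m` whose splittings are witnessed by pairs
`lt z₁ z₂` with `¬ I z₁ z₂`. -/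
def Big {Γ : Type*} (lt I : Γ → Γ → Prop) : ℕ → Set Γ → Prop
  | 0, Y => Y.Nonempty
  | m + 1, Y => ∃ z₁ z₂, lt z₁ z₂ ∧ ¬ I z₁ z₂ ∧ Big lt I m (Y ∩ {y | I z₁ y}) ∧
      Big lt I m (Y ∩ {y | I z₂ y})

namespace Big

variable {Γ : Type*} {lt I : Γ → Γ → Prop}

theorem mono {m : ℕ} {Y Z : Set Γ} (hY : Big lt I m Y) (hYZ : Y ⊆ Z) : Big lt I m Z := by
  induction m generalizing Y Z with
  | zero => exact Set.Nonempty.mono hYZ hY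
  | succ m ih =>
    obtain ⟨z₁, z₂, hlt, hn, h₁, h₂⟩ := hY
    exact ⟨z₁, z₂, hlt, hn, ih h₁ (Set.inter_subset_inter_left _ hYZ),
      ih h₂ (Set.inter_subset_inter_left _ hYZ)⟩

theorem nonempty {m : ℕ} {Y : Set Γ} (hY : Big lt I m Y) : Y.Nonempty := by
  induction m generalizing Y with
  | zero => exact hY
  | succ m ih =>
    obtain ⟨z₁, z₂, -, -, h₁, -⟩ := hY
    exact (ih h₁).mono Set.inter_subset_left

theorem of_union {p q : ℕ} {A B : Set Γ} (hAB : Big lt I (p + q) (A ∪ B)) :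
    Big lt I p A ∨ Big lt I q B := by
  induction p generalizing A B with
  | zero =>
    rcases A.eq_empty_or_nonempty with rfl | hA
    · right
      simpa using hAB
    · exact Or.inl hA
  | succ p ih =>
    rw [Nat.succ_add_eq_add_succ, Nat.add_succ] at hAB
    obtain ⟨z₁, z₂, hlt, hn, h₁, h₂⟩ := hAB
    rw [Set.union_inter_distrib_right] at h₁ h₂
    rcases ih h₁ with h₁ | h₁
    · rcases ih h₂ with h₂ | h₂
      · exact Or.inl ⟨z₁, z₂, hlt, hn, h₁, h₂⟩
      · exact Or.inr (h₂.mono Set.inter_subset_left)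
    · exact Or.inr (h₁.mono Set.inter_subset_left)

theorem of_le {p q : ℕ} {Y : Set Γ} (hY : Big lt I q Y) (hpq : p ≤ q) : Big lt I p Y := by
  obtain ⟨r, rfl⟩ := Nat.exists_eq_add_of_le hpq
  refine (of_union (A := Y) (B := ∅) (by simpa using hY)).resolve_right fun h => ?_
  exact Set.not_nonempty_empty h.nonempty

theorem exists_finset {m : ℕ} {Y : Set Γ} (hY : Big lt I m Y) :
    ∃ s : Finset Γ, ↑s ⊆ Y ∧ s.card ≤ 2 ^ m ∧ Big lt I m (s : Set Γ) := by
  classical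
  induction m generalizing Y with
  | zero =>
    obtain ⟨y, hy⟩ := hY
    exact ⟨{y}, by simpa using hy, by simp, ⟨y, by simp⟩⟩
  | succ m ih =>
    obtain ⟨z₁, z₂, hlt, hn, h₁, h₂⟩ := hY
    obtain ⟨s₁, hs₁, hc₁, hb₁⟩ := ih h₁
    obtain ⟨s₂, hs₂, hc₂, hb₂⟩ := ih h₂
    refine ⟨s₁ ∪ s₂, ?_, ?_, z₁, z₂, hlt, hn, hb₁.mono ?_, hb₂.mono ?_⟩
    · rw [Finset.coe_union]
      exact Set.union_subset (fun y hy => (hs₁ hy).1) fun y hy => (hs₂ hy).1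
    · have := Finset.card_union_le s₁ s₂
      rw [pow_succ]
      omega
    · exact fun y hy => ⟨by simp [Finset.mem_coe.1 hy], (hs₁ hy).2⟩
    · exact fun y hy => ⟨by simp [Finset.mem_coe.1 hy], (hs₂ hy).2⟩

theorem exists_homogeneous {ι : Type*} (s : Finset ι) (Q : ι → Γ → Prop) {p : ℕ} {Y : Set Γ}
    (hY : Big lt I (p * 2 ^ s.card) Y) :
    ∃ Z ⊆ Y, Big lt I p Z ∧ ∀ i ∈ s, ∀ y ∈ Z, ∀ z ∈ Z, Q i y ↔ Q i z := by
  classical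
  induction s using Finset.induction_on generalizing Y with
  | empty => exact ⟨Y, subset_rfl, by simpa using hY, by simp⟩
  | insert i s hi ih =>
    rw [Finset.card_insert_of_notMem hi, pow_succ, ← mul_assoc, mul_two,
      ← Set.inter_union_compl Y {y | Q i y}] at hY
    rcases hY.of_union with hY | hY <;> obtain ⟨Z, hZY, hZ, hQ⟩ := ih hY
    · refine ⟨Z, fun y hy => (hZY hy).1, hZ, ?_⟩
      simp only [Finset.mem_insert, forall_eq_or_imp]
      exact ⟨fun y hy z hz => iff_of_true (hZY hy).2 (hZY hz).2, hQ⟩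
    · refine ⟨Z, fun y hy => (hZY hy).1, hZ, ?_⟩
      simp only [Finset.mem_insert, forall_eq_or_imp]
      exact ⟨fun y hy z hz => iff_of_false (hZY hy).2 (hZY hz).2, hQ⟩

end Big

namespace IsLeastRightInitial

open PermStruct MinimalSubquotientOrder

variable {n : ℕ} {Γ : Type*} {S : PermStruct n Γ} {E F lt I : Γ → Γ → Prop}

theorem big (h : MinimalSubquotientOrder S E F lt) (hI : IsLeastRightInitial S E lt I) (m : ℕ)
    (x : Γ) : Big lt I m {y | I x y} := by
  induction m generalizing x with
  | zero =>
    obtain ⟨p, q, hpq⟩ := hI.nonempty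
    exact hI.definable.exists_right h.homogeneous hpq x
  | succ m ih =>
    obtain ⟨z₁, z₂, h₁, h₂, hlt, hn⟩ := hI.exists_pair h x
    exact ⟨z₁, z₂, hlt, hn, (ih z₁).mono fun y hy => ⟨hI.trans h h₁ hy, hy⟩,
      (ih z₂).mono fun y hy => ⟨hI.trans h h₂ hy, hy⟩⟩

theorem lt_of_not (h : MinimalSubquotientOrder S E F lt) (hI : IsLeastRightInitial S E lt I)
    {x y z : Γ} (hxz : lt x z) (hn : ¬ I x z) (hxy : I x y) : lt y z := by
  have hF : F y z := h.equiv_top.trans (h.equiv_top.symm (h.top_of_lt (hI.lt_of hxy)))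
    (h.top_of_lt hxz)
  exact (h.lt_or_le hF).resolve_right fun hzy => hn (hI.initial hxy hxz hzy)

/-- Two ways of separating the members of a chain by sections of `I` exclude each other. -/
theorem not_split (h : MinimalSubquotientOrder S E F lt) (hI : IsLeastRightInitial S E lt I)
    {x x' y₁ y₂ y₃ : Γ} (hy : lt y₁ y₂) (h₁ : I x y₁) (h₂ : I x y₂) (h₃ : ¬ I x y₃)
    (h₁' : ¬ I x' y₁) (h₂' : I x' y₂) (h₃' : I x' y₃) : False := by
  have hF : F x x' := h.equiv_top.trans (h.top_of_lt (hI.lt_of h₂))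
    (h.equiv_top.symm (h.top_of_lt (hI.lt_of h₂')))
  rcases h.lt_or_le hF with hlt | hle
  · exact h₃ (hI.trans h (hI.initial h₂ hlt (Or.inl (hI.lt_of h₂'))) h₃')
  · exact h₁' (hI.initial h₂' (h.lt_of_le_of_lt hle (hI.lt_of h₁)) (Or.inl hy))

theorem exists_not_big (h : MinimalSubquotientOrder S E F lt) (hI : IsLeastRightInitial S E lt I)
    (k : ℕ) : ∃ N, ∀ T : Finset (Fin n → Prop), T.card ≤ k → ∀ Y, Big lt I N Y →
      ¬ ∀ y ∈ Y, ∀ z ∈ Y, lt y z → (fun i => S.le i y z) ∈ T := by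
  classical
  induction k with
  | zero =>
    refine ⟨1, fun T hT Y hY hall => ?_⟩
    obtain ⟨z₁, z₂, hlt, hn, ⟨y₁, h₁, h₁'⟩, ⟨y₂, h₂, h₂'⟩⟩ := hY
    have := hall y₁ h₁ y₂ h₂ (h.trans (hI.lt_of_not h hlt hn h₁') (hI.lt_of h₂'))
    simp_all
  | succ k ih =>
    obtain ⟨N, hN⟩ := ih
    let L := N * 2 ^ n
    let M := N * 2 ^ (2 ^ L * n)
    refine ⟨M + L + 1, fun T hT Y hY hall => ?_⟩
    obtain ⟨z₁, z₂, hlt, hn, h₁, h₂⟩ := hY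
    obtain ⟨s, hsY, hsc, hs⟩ := (h₂.of_le (Nat.le_add_left L M)).exists_finset
    have hcard : (s ×ˢ (Finset.univ : Finset (Fin n))).card ≤ 2 ^ L * n := by
      rw [Finset.card_product, Finset.card_univ, Fintype.card_fin]
      exact Nat.mul_le_mul_right n hsc
    obtain ⟨Y₁, hY₁, hb₁, hc₁⟩ := Big.exists_homogeneous (p := N)
      (s ×ˢ (Finset.univ : Finset (Fin n))) (fun w y => S.le w.2 y w.1)
      ((h₁.of_le (Nat.le_add_right M L)).of_le
        (Nat.mul_le_mul_left N (Nat.pow_le_pow_right two_pos hcard)))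
    obtain ⟨y₀, hy₀⟩ := hb₁.nonempty
    obtain ⟨Y₂, hY₂, hb₂, hc₂⟩ := Big.exists_homogeneous (p := N)
      (Finset.univ : Finset (Fin n)) (fun i w => S.le i y₀ w) (by simpa using hs)
    obtain ⟨w₀, hw₀⟩ := hb₂.nonempty
    let u : Fin n → Prop := fun i => S.le i y₀ w₀
    have hu : ∀ y ∈ Y₁, ∀ w ∈ Y₂, ∀ i, S.le i y w ↔ u i := fun y hy w hw i =>
      (hc₁ (w, i) (by simpa using hY₂ hw) y hy y₀ hy₀).trans (hc₂ i (by simp) w hw w₀ hw₀)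
    have hlt₁₂ : ∀ y ∈ Y₁, ∀ w ∈ Y₂, lt y z₂ ∧ lt z₂ w := fun y hy w hw =>
      ⟨hI.lt_of_not h hlt hn (hY₁ hy).2, hI.lt_of (hsY (hY₂ hw)).2⟩
    have huT : u ∈ T := hall y₀ (hY₁ hy₀).1 w₀ (hsY (hY₂ hw₀)).1
      (h.trans (hlt₁₂ y₀ hy₀ w₀ hw₀).1 (hlt₁₂ y₀ hy₀ w₀ hw₀).2)
    have hTc : (T.erase u).card ≤ k := by
      rw [Finset.card_erase_of_mem huT]
      omega
    have hex : ∀ Z ⊆ Y, Big lt I N Z →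
        ∃ y ∈ Z, ∃ z ∈ Z, lt y z ∧ (fun i => S.le i y z) = u := by
      intro Z hZ hb
      by_contra! hc
      exact hN _ hTc Z hb fun y hy z hz hyz =>
        Finset.mem_erase.2 ⟨hc y hy z hz hyz, hall y (hZ hy) z (hZ hz) hyz⟩
    obtain ⟨y, hy, y', hy', hyy, hyu⟩ := hex Y₁ (fun y hy => (hY₁ hy).1) hb₁
    obtain ⟨w, hw, w', hw', hww, hwu⟩ := hex Y₂ (fun w hw => (hsY (hY₂ hw)).1) hb₂
    have hst : ∀ {a b c d : Γ}, lt a b → lt c d → (∀ i, S.le i a b ↔ u i) →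
        (∀ i, S.le i c d ↔ u i) → S.SameType a b c d := by
      intro a b c d hab hcd hl hr
      refine ⟨iff_of_false ?_ ?_, fun i => (hl i).trans (hr i).symm⟩
      · rintro rfl
        exact h.irrefl _ hab
      · rintro rfl
        exact h.irrefl _ hcd
    have hl : ∀ {y w}, y ∈ Y₁ → w ∈ Y₂ → lt y w := fun {y w} hy hw =>
      h.trans (hlt₁₂ y hy w hw).1 (hlt₁₂ y hy w hw).2
    obtain ⟨σ, hσ, e₁, e₂, e₃⟩ := h.homogeneous.exists_auto_triple
      (hst hyy (hl hy₀ hw) (fun i => iff_of_eq (congrFun hyu i)) (hu y₀ hy₀ w hw))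
      (hst (hl hy' hw₀) hww (hu y' hy' w₀ hw₀) fun i => iff_of_eq (congrFun hwu i))
      (hst (hl hy hw₀) (hl hy₀ hw') (hu y hy w₀ hw₀) (hu y₀ hy₀ w' hw'))
    have hz₁ : ¬ I z₁ w₀ := fun hc => h.asymm (hI.lt_of_not h hlt hn hc)
      (hlt₁₂ y hy w₀ hw₀).2
    refine hI.not_split h (x := σ z₁) (x' := z₂) (hl hy₀ hw) ?_ ?_ ?_ ?_
      (hsY (hY₂ hw)).2 (hsY (hY₂ hw')).2
    · exact e₁ ▸ (hI.definable σ hσ _ _).1 (hY₁ hy).2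
    · exact e₂ ▸ (hI.definable σ hσ _ _).1 (hY₁ hy').2
    · exact fun hc => hz₁ ((hI.definable σ hσ _ _).2 (e₃ ▸ hc))
    · exact fun hc => h.asymm (hI.lt_of hc) (hlt₁₂ y₀ hy₀ w₀ hw₀).1

end IsLeastRightInitial

theorem not_isLeastRightInitial {n : ℕ} {Γ : Type*} {S : PermStruct n Γ}
    {E F lt I : Γ → Γ → Prop} (h : MinimalSubquotientOrder S E F lt) :
    ¬ IsLeastRightInitial S E lt I := by
  intro hI
  obtain ⟨N, hN⟩ := hI.exists_not_big h (Fintype.card (Fin n → Prop))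
  obtain ⟨x, -⟩ := hI.nonempty
  exact hN Finset.univ le_rfl _ (hI.big h N x) fun _ _ _ _ _ => Finset.mem_univ _

namespace MinimalSubquotientOrder

open PermStruct

variable {n : ℕ} {Γ : Type*} {S : PermStruct n Γ} {E F lt G G₁ G₂ : Γ → Γ → Prop}

theorem exists_sameType_lt (h : MinimalSubquotientOrder S E F lt) {b a m : Γ} (hba : lt b a)
    (hbm : lt b m) : ∃ y, S.SameType b a b y ∧ lt y m := by
  by_contra! hc
  have hJ : IsRightInitial S E lt fun p q => lt p q ∧ ∀ y, S.SameType b a p y → ¬ lt y q :=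
    { definable := definable_of_imp fun σ hσ p q hpq =>
        ⟨(h.definable σ hσ p q).1 hpq.1, fun y hy hyq => by
          obtain ⟨y, rfl⟩ := σ.surjective y
          exact hpq.2 y (hy.trans (hσ.sameType p y).symm) ((h.definable σ hσ _ _).2 hyq)⟩
      lt_of := fun hpq => hpq.1
      initial := fun hpq hpz hzq => ⟨hpz, fun y hy hyz => hpq.2 y hy (h.lt_of_lt_of_le hyz hzq)⟩ }
  obtain ⟨a', ha'⟩ := (sameType_definable b a).exists_right h.homogeneous
    (SameType.rfl : S.SameType b a b a) a
  have haa := h.sameType_lt hba ha'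
  obtain ⟨I, hI⟩ := hJ.exists_isLeast h ⟨b, m, hbm, hc⟩
    ⟨b, a', h.trans hba haa, fun hc' => hc'.2 a SameType.rfl haa⟩
  exact not_isLeastRightInitial h hI

theorem exists_lt_of_ne (h : MinimalSubquotientOrder S E F lt) (hG : Equivalence G)
    (hEG : ∀ x y, E x y → G x y) (hGF : ∀ x y, G x y → F x y) (hne : ¬ ∀ x y, G x y ↔ E x y) :
    ∃ x y, G x y ∧ lt x y := by
  push Not at hne
  obtain ⟨x, y, ⟨hxy, hn⟩ | ⟨hn, hxy⟩⟩ := hne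
  · rcases h.trichotomy (hGF x y hxy) with h' | h' | h'
    · exact ⟨x, y, hxy, h'⟩
    · exact absurd h' hn
    · exact ⟨y, x, hG.symm hxy, h'⟩
  · exact absurd (hEG x y hxy) hn

theorem exists_between_lt (h : MinimalSubquotientOrder S E F lt) {b a m : Γ} (hba : lt b a)
    (hbm : lt b m) : ∃ c, S.SameType b a b c ∧ S.SameType b a c a ∧ lt c m := by
  obtain ⟨y, hy, hym⟩ := h.exists_sameType_lt hba hbm
  obtain ⟨b', hb'⟩ := (sameType_definable a b).exists_right h.homogeneous
    (SameType.rfl : S.SameType a b a b) b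
  have hb := hb'.swap
  obtain ⟨σ, hσ, e₁, e₂, e₃⟩ := h.homogeneous.exists_auto_triple
    ((h.sameType_trans hba hb hy).symm.trans hy) (SameType.rfl : S.SameType y a y a)
    (h.sameType_trans hba hb SameType.rfl).symm
  have h₁ := hσ.sameType b' b
  have h₂ := hσ.sameType b a
  have h₃ := hσ.sameType b y
  rw [e₁] at h₁
  rw [e₃] at h₂
  rw [e₂] at h₃
  exact ⟨σ b, hb.trans h₁, h₂, h.trans (h.sameType_lt hba (hy.trans h₃)) hym⟩

theorem exists_between_gt (h : MinimalSubquotientOrder S E F lt) {b a m : Γ} (hba : lt b a)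
    (hma : lt m a) : ∃ c, S.SameType b a b c ∧ S.SameType b a c a ∧ lt m c := by
  obtain ⟨c, h₁, h₂, hmc⟩ := h.flip.exists_between_lt hba hma
  exact ⟨c, h₂.swap, h₁.swap, hmc⟩

theorem false_of_related (h : MinimalSubquotientOrder S E F lt) (hG₁ : S.Definable G₁)
    (hG₂ : S.Definable G₂) (hG₁equiv : Equivalence G₁) (hG₂equiv : Equivalence G₂)
    (hmeet : ∀ x y, E x y ↔ G₁ x y ∧ G₂ x y) {b m a : Γ} (hbm : lt b m) (hma : lt m a)
    (hb : G₂ b m) (ha : G₁ m a) : False := by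
  have hba := h.trans hbm hma
  obtain ⟨c, hbc, hca, hcm⟩ := h.exists_between_lt hba hbm
  obtain ⟨c', hbc', hca', hmc⟩ := h.exists_between_gt hba hma
  obtain ⟨τ, hτ, e₁, e₂, e₃⟩ := h.homogeneous.exists_auto_triple
    (hbc.symm.trans hbc') (hca.symm.trans hca') (SameType.rfl : S.SameType b a b a)
  have h₁ : G₁ (τ m) m := hG₁equiv.trans (e₃ ▸ (hG₁ τ hτ m a).1 ha) (hG₁equiv.symm ha)
  have h₂ : G₂ (τ m) m := hG₂equiv.trans (hG₂equiv.symm (e₁ ▸ (hG₂ τ hτ b m).1 hb)) hb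
  have hcm' : lt c' (τ m) := e₂ ▸ (h.definable τ hτ c m).1 hcm
  exact h.asymm hmc (h.lt_of_lt_of_bot hcm' ((hmeet _ _).2 ⟨h₁, h₂⟩))

end MinimalSubquotientOrder

/-- In a homogeneous `n`-dimensional permutation structure, let `<` be a ∅-definable
subquotient order from `E` to `F` which is `H`-convex for no ∅-definable equivalence relation
`H` strictly between `E` and `F`. If `E = G₁ ⊓ G₂` with `G₁ ≠ E ≠ G₂` ∅-definable equivalence
relations, then the join `G₁ ⊔ G₂` does not refine `F`. -/
theorem join_does_not_refine_top
    {n : ℕ} {Γ : Type*} [Countable Γ] [Infinite Γ] (S : PermStruct n Γ)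
    (hhom : S.Homogeneous)
    (E F G₁ G₂ : Γ → Γ → Prop) (lt : Γ → Γ → Prop)
    (hEdef : S.Definable E) (hEequiv : Equivalence E)
    (hFdef : S.Definable F) (hFequiv : Equivalence F)
    (hG₁def : S.Definable G₁) (hG₁equiv : Equivalence G₁)
    (hG₂def : S.Definable G₂) (hG₂equiv : Equivalence G₂)
    (hEF : ∀ x y, E x y → F x y)
    (hlt : IsSubquotientOrder E F lt) (hltdef : S.Definable lt)
    (hnoconv : ∀ H : Γ → Γ → Prop, S.Definable H → Equivalence H →
      (∀ x y, E x y → H x y) → (¬ ∀ x y, H x y → E x y) →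
      (∀ x y, H x y → F x y) → (¬ ∀ x y, F x y → H x y) →
      ¬ (∀ x y z, lt x y → lt y z → H x z → H x y))
    (hmeet : ∀ x y, E x y ↔ G₁ x y ∧ G₂ x y)
    (hG₁ne : ¬ ∀ x y, G₁ x y ↔ E x y) (hG₂ne : ¬ ∀ x y, G₂ x y ↔ E x y) :
    ¬ ∀ x y, Relation.TransGen (fun u v => G₁ u v ∨ G₂ u v) x y → F x y := by
  intro hjoin
  have h : MinimalSubquotientOrder S E F lt :=
    ⟨hhom, hEdef, hEequiv, hFequiv, hEF, hlt, hltdef, hnoconv⟩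
  obtain ⟨m, a, hG₁, hma⟩ := h.exists_lt_of_ne hG₁equiv (fun x y hxy => ((hmeet x y).1 hxy).1)
    (fun x y hxy => hjoin x y (.single (Or.inl hxy))) hG₁ne
  obtain ⟨b', m', hG₂', hbm'⟩ := h.exists_lt_of_ne hG₂equiv
    (fun x y hxy => ((hmeet x y).1 hxy).2)
    (fun x y hxy => hjoin x y (.single (Or.inr hxy))) hG₂ne
  obtain ⟨σ, hσ, rfl⟩ := hhom.exists_auto_apply_eq m' m
  exact h.false_of_related hG₁def hG₂def hG₁equiv hG₂equiv hmeet ((hltdef σ hσ _ _).1 hbm') hma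
    ((hG₂def σ hσ _ _).1 hG₂') hG₁
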